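/- Let Z ∈ M_n(ℝ₊), let 1 ≤ k ≤ n, and suppose Z = ⊕_{i=1}^{s} x_i⊗y_iᵗ (entrywise maximum of the rank-one matrices x_i⊗y_iᵗ) for some vectors x_i, y_i ∈ ℝ₊ⁿ, 1 ≤ i ≤ s. Then Λ_k^max(Z) ⊆ ⋃_{j=1}^{s} W_max(x_j⊗y_jᵗ). -/

import Mathlib

open Matrix

namespace MaxAlg

variable {I J K : Type*}

/-- Entrywise nonnegative matrix (matrix over `ℝ₊`). -/
def Nonneg (A : Matrix I J ℝ) : Prop := ∀ i j, 0 ≤ A i j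

/-- Max-algebra matrix product: `(A ⊗ B) i k = max_j (A i j * B j k)`. -/
noncomputable def maxMul [Fintype J] (A : Matrix I J ℝ) (B : Matrix J K ℝ) :
    Matrix I K ℝ :=
  Matrix.of fun i k => ⨆ j, A i j * B j k

/-- Max trace: `tr_⊗(M) = max_i M i i`. -/
noncomputable def maxTrace (M : Matrix I I ℝ) : ℝ := ⨆ i, M i i

/-- Max isometry: a nonnegative matrix `X` with `Xᵗ ⊗ X = I`. -/
def IsMaxIsometry [Fintype I] [Fintype J] [DecidableEq J] (X : Matrix I J ℝ) : Prop :=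
  Nonneg X ∧ maxMul Xᵀ X = 1

/-- Max numerical range `W_max(A) = {xᵗ⊗A⊗x : x ∈ ℝ₊ⁿ, xᵗ⊗x = 1}`,
vectors being treated as `n × 1` matrices. -/
noncomputable def WMax [Fintype I] (A : Matrix I I ℝ) : Set ℝ :=
  {r | ∃ x : Matrix I (Fin 1) ℝ, Nonneg x ∧ maxMul xᵀ x = 1 ∧
    r = maxMul xᵀ (maxMul A x) 0 0}

/-- Max rank-`k` numerical range
`Λ_k^max(A) = {λ ∈ ℝ₊ : Xᵗ⊗A⊗X = λ I_k for some max isometry X}`. -/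
noncomputable def LambdaMax [Fintype I] (k : ℕ) (A : Matrix I I ℝ) : Set ℝ :=
  {lam | 0 ≤ lam ∧ ∃ X : Matrix I (Fin k) ℝ, IsMaxIsometry X ∧
    maxMul Xᵀ (maxMul A X) = lam • (1 : Matrix (Fin k) (Fin k) ℝ)}

/-- Max `k`-numerical range `W_max^k(A) = {tr_⊗(Xᵗ⊗A⊗X) : X ∈ 𝒳_{n×k}}`. -/
noncomputable def WMaxK [Fintype I] (k : ℕ) (A : Matrix I I ℝ) : Set ℝ :=
  {r | ∃ X : Matrix I (Fin k) ℝ, IsMaxIsometry X ∧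
    r = maxTrace (maxMul Xᵀ (maxMul A X))}

/-- Max joint `k`-numerical range of an `m`-tuple of matrices. -/
noncomputable def WMaxKJoint [Fintype I] {m : ℕ} (k : ℕ)
    (A : Fin m → Matrix I I ℝ) : Set (Fin m → ℝ) :=
  {v | ∃ X : Matrix I (Fin k) ℝ, IsMaxIsometry X ∧
    ∀ l, v l = maxTrace (maxMul Xᵀ (maxMul (A l) X))}

/-- Sup-norm of a real matrix: maximum absolute value of an entry. -/
noncomputable def matNorm (M : Matrix I J ℝ) : ℝ := ⨆ i, ⨆ j, |M i j|

/-- Sup-norm of a real vector: maximum absolute value of an entry. -/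
noncomputable def vecNorm (v : I → ℝ) : ℝ := ⨆ i, |v i|

/-- Entrywise maximum (`max sum`) of two matrices. -/
def maxAdd (A B : Matrix I J ℝ) : Matrix I J ℝ :=
  Matrix.of fun i j => max (A i j) (B i j)

/-- Max joint `c`-numerical range of an `m`-tuple of matrices:
`{(max_i c_i (xᵢᵗ⊗A₁⊗xᵢ), …) : X = [x₁,…,xₙ] max unitary}`; note that
`xᵢᵗ⊗A⊗xᵢ` is the `(i,i)` entry of `Xᵗ⊗A⊗X`. -/
noncomputable def WMaxCJoint {n m : ℕ} (c : Fin n → ℝ)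
    (A : Fin m → Matrix (Fin n) (Fin n) ℝ) : Set (Fin m → ℝ) :=
  {v | ∃ U : Matrix (Fin n) (Fin n) ℝ, IsMaxIsometry U ∧
    ∀ l, v l = ⨆ i, c i * maxMul Uᵀ (maxMul (A l) U) i i}

/-- Max joint `C`-numerical range of an `m`-tuple of matrices:
`{(tr_⊗(C⊗Xᵗ⊗A₁⊗X), …) : X max unitary}`. -/
noncomputable def WMaxBigCJoint {n m : ℕ} (C : Matrix (Fin n) (Fin n) ℝ)
    (A : Fin m → Matrix (Fin n) (Fin n) ℝ) : Set (Fin m → ℝ) :=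
  {v | ∃ X : Matrix (Fin n) (Fin n) ℝ, IsMaxIsometry X ∧
    ∀ l, v l = maxTrace (maxMul C (maxMul Xᵀ (maxMul (A l) X)))}

theorem maxMul_mono [Fintype J] {A A' : Matrix I J ℝ} {B B' : Matrix J K ℝ}
    (hA : Nonneg A) (hB' : Nonneg B') (hAA' : ∀ i j, A i j ≤ A' i j)
    (hBB' : ∀ i j, B i j ≤ B' i j) (i : I) (k : K) :
    maxMul A B i k ≤ maxMul A' B' i k :=
  ciSup_mono (Set.finite_range _).bddAbove fun j =>
    (mul_le_mul_of_nonneg_left (hBB' j k) (hA i j)).trans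
      (mul_le_mul_of_nonneg_right (hAA' i j) (hB' j k))

theorem le_maxMul [Fintype J] (A : Matrix I J ℝ) (B : Matrix J K ℝ) (i : I) (j : J) (k : K) :
    A i j * B j k ≤ maxMul A B i k :=
  le_ciSup (f := fun j => A i j * B j k) (Set.finite_range _).bddAbove j

theorem exists_maxMul_eq [Fintype J] [Nonempty J] (A : Matrix I J ℝ) (B : Matrix J K ℝ)
    (i : I) (k : K) : ∃ j, A i j * B j k = maxMul A B i k :=
  exists_eq_ciSup_of_finite (f := fun j => A i j * B j k)

theorem Nonneg.maxMul [Fintype J] {A : Matrix I J ℝ} {B : Matrix J K ℝ}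
    (hA : Nonneg A) (hB : Nonneg B) : Nonneg (maxMul A B) := fun i k =>
  Real.iSup_nonneg fun j => mul_nonneg (hA i j) (hB j k)

/-- A quadratic form in max algebra of an entrywise maximum of finitely many matrices is
attained by one of these matrices. -/
theorem exists_maxMul_iSup_eq {L : Type*} [Finite L] [Nonempty L] [Fintype I] [Nonempty I]
    (M : L → Matrix I I ℝ) (hM : ∀ l, Nonneg (M l)) {u : Matrix I K ℝ}
    (hu : Nonneg u) (a b : K) :
    ∃ l, maxMul uᵀ (maxMul (Matrix.of fun i j => ⨆ l, M l i j) u) a b =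
      maxMul uᵀ (maxMul (M l) u) a b := by
  set Z : Matrix I I ℝ := Matrix.of fun i j => ⨆ l, M l i j with hZ
  have hut : Nonneg uᵀ := fun i j => hu j i
  have hle (l : L) (i j : I) : M l i j ≤ Z i j :=
    le_ciSup (f := fun l => M l i j) (Set.finite_range _).bddAbove l
  have hZ0 : Nonneg Z := fun i j => Real.iSup_nonneg fun l => hM l i j
  obtain ⟨i, hi⟩ := exists_maxMul_eq uᵀ (maxMul Z u) a b
  obtain ⟨j, hj⟩ := exists_maxMul_eq Z u i b
  obtain ⟨l, hl⟩ := exists_eq_ciSup_of_finite (f := fun l => M l i j)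
  have hl : M l i j = Z i j := hl
  refine ⟨l, le_antisymm ?_ ?_⟩
  · rw [← hi, ← hj, ← hl]
    exact (mul_le_mul_of_nonneg_left (le_maxMul (M l) u i j b) (hut a i)).trans
      (le_maxMul uᵀ (maxMul (M l) u) a i b)
  · exact maxMul_mono hut (hZ0.maxMul hu) (fun _ _ => le_rfl)
      (maxMul_mono (hM l) hu (hle l) fun _ _ => le_rfl) a b

/-- if `Z = ⊕_{l=1}^s x_l ⊗ y_lᵗ` entrywise, then
`Λ_k^max(Z) ⊆ ⋃_l W_max(x_l ⊗ y_lᵗ)`. -/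
theorem lambdaMax_subset_union_wmax {n : ℕ} (hn : 0 < n) {k : ℕ}
    (hk1 : 1 ≤ k) (hkn : k ≤ n) {s : ℕ} (hs : 0 < s)
    (x y : Fin s → Fin n → ℝ) (hx : ∀ l i, 0 ≤ x l i) (hy : ∀ l i, 0 ≤ y l i)
    (Z : Matrix (Fin n) (Fin n) ℝ)
    (hZ : Z = Matrix.of fun i j => ⨆ l, x l i * y l j) :
    LambdaMax k Z ⊆ ⋃ l : Fin s, WMax (Matrix.vecMulVec (x l) (y l)) := by
  rintro lam ⟨-, X, ⟨hX0, hX1⟩, hX⟩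
  subst hZ
  have : Nonempty (Fin n) := ⟨⟨0, hn⟩⟩
  have : Nonempty (Fin s) := ⟨⟨0, hs⟩⟩
  let c : Fin k := ⟨0, hk1⟩
  let u : Matrix (Fin n) (Fin 1) ℝ := X.submatrix id fun _ => c
  obtain ⟨l, hl⟩ := exists_maxMul_iSup_eq (fun l => Matrix.vecMulVec (x l) (y l))
    (fun l i j => mul_nonneg (hx l i) (hy l j)) (u := u) (fun i _ => hX0 i c) 0 0
  refine Set.mem_iUnion.2 ⟨l, u, fun i _ => hX0 i c, ?_, ?_⟩
  · ext a b
    rw [Subsingleton.elim b a, Matrix.one_apply_eq]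
    exact (congrFun₂ hX1 c c).trans (Matrix.one_apply_eq c)
  · rw [← hl]
    have hc := congrFun₂ hX c c
    rw [Matrix.smul_apply, Matrix.one_apply_eq, smul_eq_mul, mul_one] at hc
    exact hc.symm

end MaxAlg
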